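/- Let A be a C*-algebra, φ an extreme point of the set of tracial states of A, with GNS triple (π_φ, H_φ, ξ_φ). Then the von Neumann algebra π_φ(A)'' is a factor, i.e. its center is ℂ·1. -/

import Mathlib

open scoped ComplexOrder InnerProductSpace

section GNS

variable {A : Type*} [CStarAlgebra A] {H : Type*} [NormedAddCommGroup H]
  [InnerProductSpace ℂ H] [CompleteSpace H]

/-- The functional `a ↦ ⟪ξ, T π(a) ξ⟫`. -/
noncomputable def twistedState (π : A →⋆ₐ[ℂ] (H →L[ℂ] H)) (ξ : H) (T : H →L[ℂ] H) : A →L[ℂ] ℂ :=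
  LinearMap.mkContinuous
    { toFun := fun a => ⟪ξ, T (π a ξ)⟫_ℂ
      map_add' := fun a b => by simp
      map_smul' := fun c a => by simp }
    (‖ξ‖ * (‖T‖ * ‖ξ‖)) (fun a => by
      have h : ‖π a‖ ≤ ‖a‖ := NonUnitalStarAlgHom.norm_apply_le π a
      calc ‖⟪ξ, T (π a ξ)⟫_ℂ‖ ≤ ‖ξ‖ * ‖T (π a ξ)‖ := norm_inner_le_norm _ _
        _ ≤ ‖ξ‖ * (‖T‖ * (‖π a‖ * ‖ξ‖)) := by
          gcongr
          exact (T.le_opNorm _).trans (by gcongr; exact (π a).le_opNorm _)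
        _ ≤ ‖ξ‖ * (‖T‖ * (‖a‖ * ‖ξ‖)) := by gcongr
        _ = ‖ξ‖ * (‖T‖ * ‖ξ‖) * ‖a‖ := by ring)

@[simp]
lemma twistedState_apply (π : A →⋆ₐ[ℂ] (H →L[ℂ] H)) (ξ : H) (T : H →L[ℂ] H) (a : A) :
    twistedState π ξ T a = ⟪ξ, T (π a ξ)⟫_ℂ := rfl

lemma inner_map_star_left (π : A →⋆ₐ[ℂ] (H →L[ℂ] H)) (a : A) (v w : H) :
    ⟪π (star a) v, w⟫_ℂ = ⟪v, π a w⟫_ℂ := by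
  rw [map_star, ContinuousLinearMap.star_eq_adjoint, ContinuousLinearMap.adjoint_inner_left]

lemma inner_map_left (π : A →⋆ₐ[ℂ] (H →L[ℂ] H)) (a : A) (v w : H) :
    ⟪π a v, w⟫_ℂ = ⟪v, π (star a) w⟫_ℂ := by
  rw [← inner_map_star_left, star_star]

lemma inner_gns {π : A →⋆ₐ[ℂ] (H →L[ℂ] H)} {ξ : H} {φ : A →L[ℂ] ℂ}
    (hGNS : ∀ a : A, φ a = ⟪ξ, π a ξ⟫_ℂ) (a b : A) :
    ⟪π a ξ, π b ξ⟫_ℂ = φ (star a * b) := by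
  rw [hGNS, inner_map_left, map_mul, mul_apply_eq_comp]

lemma norm_map_star_gns {π : A →⋆ₐ[ℂ] (H →L[ℂ] H)} {ξ : H} {φ : A →L[ℂ] ℂ}
    (htr : ∀ a b : A, φ (a * b) = φ (b * a)) (hGNS : ∀ a : A, φ a = ⟪ξ, π a ξ⟫_ℂ) (a : A) :
    ‖π (star a) ξ‖ = ‖π a ξ‖ := by
  have h : ⟪π (star a) ξ, π (star a) ξ⟫_ℂ = ⟪π a ξ, π a ξ⟫_ℂ := by
    rw [inner_gns hGNS, inner_gns hGNS, htr, star_star]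
  rw [@norm_eq_sqrt_re_inner ℂ, @norm_eq_sqrt_re_inner ℂ, h]

/-- In the GNS representation of a trace, right multiplication by `b` is bounded. -/
lemma exists_rightMul_gns {π : A →⋆ₐ[ℂ] (H →L[ℂ] H)} {ξ : H} {φ : A →L[ℂ] ℂ}
    (htr : ∀ a b : A, φ (a * b) = φ (b * a)) (hGNS : ∀ a : A, φ a = ⟪ξ, π a ξ⟫_ℂ)
    (hcyclic : DenseRange fun a : A => π a ξ) (b : A) :
    ∃ R : H →L[ℂ] H, ∀ x, R (π x ξ) = π (x * b) ξ := by
  let e : A →ₗ[ℂ] H :=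
    { toFun := fun a => π a ξ
      map_add' := fun a b => by simp
      map_smul' := fun c a => by simp }
  refine ⟨(e ∘ₗ LinearMap.mulRight ℂ b).extendOfNorm e, fun x => ?_⟩
  refine LinearMap.extendOfNorm_eq (f := e ∘ₗ LinearMap.mulRight ℂ b) (e := e) hcyclic
    ⟨‖π (star b)‖, fun x => ?_⟩ x
  change ‖π (x * b) ξ‖ ≤ ‖π (star b)‖ * ‖π x ξ‖
  rw [← norm_map_star_gns htr hGNS, ← norm_map_star_gns htr hGNS x, star_mul, map_mul]
  exact (π (star b)).le_opNorm _

/-- The vector state of a trace, twisted by an element of the center of the generated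
von Neumann algebra, is again tracial. -/
lemma twistedState_mul_comm {π : A →⋆ₐ[ℂ] (H →L[ℂ] H)} {ξ : H} {φ : A →L[ℂ] ℂ}
    (htr : ∀ a b : A, φ (a * b) = φ (b * a)) (hGNS : ∀ a : A, φ a = ⟪ξ, π a ξ⟫_ℂ)
    (hcyclic : DenseRange fun a : A => π a ξ) {T : H →L[ℂ] H}
    (hT : ∀ a v, T (π a v) = π a (T v))
    (hT' : T ∈ Set.centralizer (Set.centralizer (Set.range fun a : A => π a))) (a b : A) :
    twistedState π ξ T (a * b) = twistedState π ξ T (b * a) := by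
  obtain ⟨R, hR⟩ := exists_rightMul_gns htr hGNS hcyclic b
  have hRc : R ∈ Set.centralizer (Set.range fun a : A => π a) := by
    rintro _ ⟨c, rfl⟩
    refine ContinuousLinearMap.ext fun v => ?_
    refine hcyclic.induction_on (p := fun v => (π c * R) v = (R * π c) v) v
      (isClosed_eq (by fun_prop) (by fun_prop)) fun x => ?_
    have h := hR (c * x)
    simp only [map_mul, mul_apply_eq_comp, hR] at h ⊢
    exact h.symm
  have hTR : ∀ v, R (T v) = T (R v) := fun v => by simpa using congr($(hT' R hRc) v)
  have hadj : ∀ v, ⟪ξ, R v⟫_ℂ = ⟪π (star b) ξ, v⟫_ℂ := fun v => by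
    refine hcyclic.induction_on (p := fun v => ⟪ξ, R v⟫_ℂ = ⟪π (star b) ξ, v⟫_ℂ) v
      (isClosed_eq (by fun_prop) (by fun_prop)) fun x => ?_
    rw [hR, inner_gns hGNS, ← hGNS, star_star, htr]
  rw [twistedState_apply, ← hR, ← hTR, hadj, inner_map_star_left, ← hT, twistedState_apply,
    map_mul, mul_apply_eq_comp]

/-- A positive operator commuting with the representation twists a vector functional to
a positive functional. -/
lemma twistedState_star_mul_self_nonneg {π : A →⋆ₐ[ℂ] (H →L[ℂ] H)} {ξ : H} {S : H →L[ℂ] H}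
    (hS : 0 ≤ S) (hc : ∀ a v, S (π a v) = π a (S v)) (x : A) :
    0 ≤ twistedState π ξ S (star x * x) := by
  rw [twistedState_apply, map_mul, mul_apply_eq_comp, hc, ← inner_map_left]
  exact ((ContinuousLinearMap.nonneg_iff_isPositive S).1 hS).inner_nonneg_right _

lemma norm_twistedState_eq_one [Nontrivial A] {π : A →⋆ₐ[ℂ] (H →L[ℂ] H)} {ξ : H} {S : H →L[ℂ] H}
    (hS : 0 ≤ S) (hc : ∀ a v, S (π a v) = π a (S v)) (h1 : ⟪ξ, S ξ⟫_ℂ = 1) :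
    ‖twistedState π ξ S‖ = 1 := by
  set Q := CFC.sqrt S with hQ
  have hQQ : Q * Q = S := CFC.sqrt_mul_sqrt_self S hS
  have hQsa : IsSelfAdjoint Q := (CFC.sqrt_nonneg S).isSelfAdjoint
  have hQc : ∀ a v, Q (π a v) = π a (Q v) := fun a v => by
    have h : Commute S (π a) := ContinuousLinearMap.ext fun v => hc a v
    exact congr($((h.cfcₙ_nnreal NNReal.sqrt).eq) v)
  have hin : ∀ v w, ⟪v, S w⟫_ℂ = ⟪Q v, Q w⟫_ℂ := fun v w => by
    rw [← hQQ, mul_apply_eq_comp, ← ContinuousLinearMap.adjoint_inner_left,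
      hQsa.adjoint_eq]
  have hn : ‖Q ξ‖ = 1 := by
    rw [@norm_eq_sqrt_re_inner ℂ, ← hin, h1]
    simp
  refine le_antisymm (ContinuousLinearMap.opNorm_le_bound _ zero_le_one fun a => ?_) ?_
  · rw [twistedState_apply, hin, hQc, one_mul]
    calc ‖⟪Q ξ, π a (Q ξ)⟫_ℂ‖ ≤ ‖Q ξ‖ * (‖π a‖ * ‖Q ξ‖) :=
          (norm_inner_le_norm _ _).trans (by gcongr; exact (π a).le_opNorm _)
      _ = ‖π a‖ := by rw [hn]; ring
      _ ≤ ‖a‖ := NonUnitalStarAlgHom.norm_apply_le π a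
  · have h := (twistedState π ξ S).le_opNorm 1
    simpa [h1] using h

/-- A self-adjoint operator `T` commuting with the GNS representation of an extremal trace and
twisting it to a tracial functional vanishes if `⟪ξ, T ξ⟫ = 0`. -/
lemma eq_zero_of_extremal_trace {φ : A →L[ℂ] ℂ}
    (hext : φ ∈ Set.extremePoints ℝ
      {ψ : A →L[ℂ] ℂ | ‖ψ‖ = 1 ∧ (∀ x : A, 0 ≤ ψ (star x * x)) ∧
        ∀ a b : A, ψ (a * b) = ψ (b * a)})
    {π : A →⋆ₐ[ℂ] (H →L[ℂ] H)} {ξ : H}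
    (hcyclic : DenseRange fun a : A => π a ξ)
    (hGNS : ∀ a : A, φ a = ⟪ξ, π a ξ⟫_ℂ) {K : H →L[ℂ] H} (hsa : IsSelfAdjoint K)
    (hK : ‖K‖ ≤ 1) (hc : ∀ a v, K (π a v) = π a (K v))
    (htr : ∀ a b, twistedState π ξ K (a * b) = twistedState π ξ K (b * a))
    (h0 : ⟪ξ, K ξ⟫_ℂ = 0) : K = 0 := by
  obtain ⟨⟨hφn, -, hφtr⟩, hφe⟩ := hext
  have hA : Nontrivial A := by
    by_contra h
    rw [not_nontrivial_iff_subsingleton] at h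
    rw [Subsingleton.elim φ 0] at hφn
    simp at hφn
  have hξξ : ⟪ξ, ξ⟫_ℂ = ((‖ξ‖ ^ 2 : ℝ) : ℂ) := by
    rw [inner_self_eq_norm_sq_to_K]; norm_cast
  have hξ : ⟪ξ, ξ⟫_ℂ = 1 := by
    have hle : ‖ξ‖ ^ 2 ≤ 1 := by
      have h := φ.le_opNorm 1
      rw [hφn, hGNS, map_one, one_apply_eq_self, hξξ, CStarRing.norm_one,
        Complex.norm_real, Real.norm_of_nonneg (by positivity), mul_one] at h
      exact h
    have hge : ‖φ‖ ≤ ‖ξ‖ ^ 2 := φ.opNorm_le_bound (by positivity) fun a => by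
      have hπ : ‖π a‖ ≤ ‖a‖ := NonUnitalStarAlgHom.norm_apply_le π a
      rw [hGNS]
      calc ‖⟪ξ, π a ξ⟫_ℂ‖ ≤ ‖ξ‖ * (‖π a‖ * ‖ξ‖) :=
            (norm_inner_le_norm _ _).trans (by gcongr; exact (π a).le_opNorm _)
        _ ≤ ‖ξ‖ * (‖a‖ * ‖ξ‖) := by gcongr
        _ = ‖ξ‖ ^ 2 * ‖a‖ := by ring
    rw [hξξ, le_antisymm hle (hφn ▸ hge), Complex.ofReal_one]
  have mem : ∀ L : H →L[ℂ] H, IsSelfAdjoint L → ‖L‖ ≤ 1 → (∀ a v, L (π a v) = π a (L v)) →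
      (∀ a b, twistedState π ξ L (a * b) = twistedState π ξ L (b * a)) → ⟪ξ, L ξ⟫_ℂ = 0 →
      twistedState π ξ (1 + L) ∈ {ψ : A →L[ℂ] ℂ | ‖ψ‖ = 1 ∧ (∀ x : A, 0 ≤ ψ (star x * x)) ∧
        ∀ a b : A, ψ (a * b) = ψ (b * a)} := by
    intro L hLsa hLn hLc hLtr hL0
    have hpos : 0 ≤ 1 + L := by
      have h1 := hLsa.neg_algebraMap_norm_le_self
      have h2 : algebraMap ℝ (H →L[ℂ] H) ‖L‖ ≤ 1 := by
        simpa using algebraMap_mono (H →L[ℂ] H) hLn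
      exact neg_le_iff_add_nonneg'.1 ((neg_le_neg h2).trans h1)
    have hcom : ∀ a v, (1 + L) (π a v) = π a ((1 + L) v) := fun a v => by simp [hLc]
    refine ⟨norm_twistedState_eq_one hpos hcom
      (by rw [add_apply, one_apply_eq_self, inner_add_right, hξ, hL0, add_zero]),
      twistedState_star_mul_self_nonneg hpos hcom, fun a b => ?_⟩
    have h1 := hLtr a b
    have h2 := hφtr a b
    rw [hGNS, hGNS] at h2
    simp only [twistedState_apply] at h1
    simp only [twistedState_apply, add_apply, inner_add_right, h1,
      one_apply_eq_self, h2]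
  have hp := mem K hsa hK hc htr h0
  have hm := mem (-K) hsa.neg (by rwa [norm_neg]) (fun a v => by simp [hc])
    (fun a b => by simpa using htr a b) (by simp [h0])
  have heq : twistedState π ξ (1 + K) = φ := hφe hp hm
    ⟨1 / 2, 1 / 2, by norm_num, by norm_num, by norm_num, by
      ext a
      simp only [add_apply, smul_apply,
        twistedState_apply, one_apply_eq_self, neg_apply,
        inner_add_right, inner_neg_right, hGNS, Complex.real_smul]
      push_cast
      ring⟩
  have hzero : ∀ a, ⟪ξ, K (π a ξ)⟫_ℂ = 0 := fun a => by
    have h := congr($heq a)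
    rw [hGNS] at h
    simpa [inner_add_right] using h
  have hKv : ∀ v w, ⟪v, K w⟫_ℂ = 0 := fun v w => by
    refine hcyclic.induction_on₂ (p := fun v w => ⟪v, K w⟫_ℂ = 0)
      (isClosed_eq (by fun_prop) (by fun_prop)) (fun x y => ?_) v w
    rw [inner_map_left, ← hc, ← mul_apply_eq_comp (π (star x)), ← map_mul, hzero]
  exact ContinuousLinearMap.ext fun w => inner_self_eq_zero.1 (hKv (K w) w)

/-- A self-adjoint operator commuting with the GNS representation of an extremal trace and
twisting it to a tracial functional is a scalar. -/
lemma exists_eq_smul_one_of_isSelfAdjoint {φ : A →L[ℂ] ℂ}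
    (hext : φ ∈ Set.extremePoints ℝ
      {ψ : A →L[ℂ] ℂ | ‖ψ‖ = 1 ∧ (∀ x : A, 0 ≤ ψ (star x * x)) ∧
        ∀ a b : A, ψ (a * b) = ψ (b * a)})
    {π : A →⋆ₐ[ℂ] (H →L[ℂ] H)} {ξ : H}
    (hcyclic : DenseRange fun a : A => π a ξ)
    (hGNS : ∀ a : A, φ a = ⟪ξ, π a ξ⟫_ℂ) {T : H →L[ℂ] H} (hsa : IsSelfAdjoint T)
    (hc : ∀ a v, T (π a v) = π a (T v))
    (htr : ∀ a b, twistedState π ξ T (a * b) = twistedState π ξ T (b * a)) :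
    ∃ c : ℂ, T = c • (1 : H →L[ℂ] H) := by
  have hφtr := hext.1.2.2
  set r : ℝ := (⟪ξ, T ξ⟫_ℂ).re / ‖ξ‖ ^ 2 with hr
  set D : H →L[ℂ] H := T - (r : ℂ) • 1 with hD
  set s : ℝ := (‖D‖ + 1)⁻¹ with hs
  have hspos : 0 < s := by positivity
  have hDsa : IsSelfAdjoint D := hsa.sub (.smul (by simp [isSelfAdjoint_iff]) (.one _))
  have hD0 : ⟪ξ, D ξ⟫_ℂ = 0 := by
    rcases eq_or_ne ξ 0 with h | h
    · simp [h]
    have hre : (((⟪ξ, T ξ⟫_ℂ).re : ℝ) : ℂ) = ⟪ξ, T ξ⟫_ℂ := by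
      rw [← Complex.conj_eq_iff_re, inner_conj_symm, ← ContinuousLinearMap.adjoint_inner_right,
        hsa.adjoint_eq]
    have hξ : (‖ξ‖ : ℂ) ≠ 0 := by simpa using h
    simp only [hD, hr, sub_apply, smul_apply,
      one_apply_eq_self, inner_sub_right, inner_smul_right,
      inner_self_eq_norm_sq_to_K, Complex.ofReal_div, hre, Complex.ofReal_pow,
      Complex.coe_algebraMap]
    field_simp
    simp
  have hzero : (s : ℂ) • D = 0 := by
    refine eq_zero_of_extremal_trace hext hcyclic hGNS
      (.smul (by simp [isSelfAdjoint_iff]) hDsa) ?_ (fun a v => by simp [hD, hc]) (fun a b => ?_)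
      (by simp [hD0])
    · rw [norm_smul, Complex.norm_real, Real.norm_of_nonneg hspos.le, hs,
        inv_mul_le_one₀ (by positivity)]
      linarith
    · have h1 := htr a b
      have h2 := hφtr a b
      rw [hGNS, hGNS] at h2
      simp only [twistedState_apply] at h1
      simp only [twistedState_apply, hD, smul_apply,
        sub_apply, one_apply_eq_self, inner_smul_right,
        inner_sub_right, h1, h2]
  have hs' : (s : ℂ) ≠ 0 := by exact_mod_cast hspos.ne'
  exact ⟨r, sub_eq_zero.1 ((smul_eq_zero.1 hzero).resolve_left hs')⟩

end GNS

/-- If `φ` is an extreme point of the set of tracial states of a C*-algebra `A`, with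
GNS triple `(π, H, ξ)`, then the von Neumann algebra `π(A)''` is a factor, i.e. every
element of its center is a scalar multiple of the identity. -/
theorem stmt3 {A : Type*} [CStarAlgebra A] [PartialOrder A] [StarOrderedRing A]
    {H : Type*} [NormedAddCommGroup H] [InnerProductSpace ℂ H] [CompleteSpace H]
    (φ : A →L[ℂ] ℂ)
    (hext : φ ∈ Set.extremePoints ℝ
      {ψ : A →L[ℂ] ℂ | ‖ψ‖ = 1 ∧ (∀ x : A, 0 ≤ ψ (star x * x)) ∧
        ∀ a b : A, ψ (a * b) = ψ (b * a)})
    (π : A →⋆ₐ[ℂ] (H →L[ℂ] H)) (ξ : H)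
    (hcyclic : DenseRange fun a : A => π a ξ)
    (hGNS : ∀ a : A, φ a = ⟪ξ, π a ξ⟫_ℂ) :
    ∀ T ∈ Set.centralizer (Set.centralizer (Set.range fun a : A => π a)) ∩
        Set.centralizer (Set.centralizer (Set.centralizer (Set.range fun a : A => π a))),
      ∃ c : ℂ, T = c • (1 : H →L[ℂ] H) := by
  rintro T ⟨hT2, hT3⟩
  have hφtr := hext.1.2.2
  rw [Set.centralizer_centralizer_centralizer] at hT3
  have hstar2 : star T ∈ Set.centralizer (Set.centralizer (Set.range fun a : A => π a)) := by
    refine Set.star_mem_centralizer' (fun S hS => ?_) hT2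
    refine Set.star_mem_centralizer' ?_ hS
    rintro _ ⟨a, rfl⟩
    exact ⟨star a, map_star π a⟩
  have hstar3 : star T ∈ Set.centralizer (Set.range fun a : A => π a) := by
    refine Set.star_mem_centralizer' ?_ hT3
    rintro _ ⟨a, rfl⟩
    exact ⟨star a, map_star π a⟩
  have key : ∀ S : H →L[ℂ] H, IsSelfAdjoint S →
      S ∈ Set.centralizer (Set.centralizer (Set.range fun a : A => π a)) →
      S ∈ Set.centralizer (Set.range fun a : A => π a) → ∃ c : ℂ, S = c • (1 : H →L[ℂ] H) := by
    intro S hS h2 h3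
    have hc : ∀ a v, S (π a v) = π a (S v) := fun a v => congr($(h3 (π a) ⟨a, rfl⟩) v).symm
    exact exists_eq_smul_one_of_isSelfAdjoint hext hcyclic hGNS hS hc
      (twistedState_mul_comm hφtr hGNS hcyclic hc h2)
  have hsmul : ∀ (s : Set (H →L[ℂ] H)) (c : ℂ) (S : H →L[ℂ] H), S ∈ s.centralizer →
      c • S ∈ s.centralizer := fun s c S hS m hm => by
    rw [mul_smul_comm, smul_mul_assoc, hS m hm]
  obtain ⟨c, hc⟩ := key (T + star T) (.add_star_self T) (Set.add_mem_centralizer hT2 hstar2)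
    (Set.add_mem_centralizer hT3 hstar3)
  obtain ⟨d, hd⟩ := key (Complex.I • (T - star T))
    (by simp [isSelfAdjoint_iff, ← smul_neg])
    (hsmul _ _ _ (by rw [sub_eq_add_neg]
                     exact Set.add_mem_centralizer hT2 (Set.neg_mem_centralizer hstar2)))
    (hsmul _ _ _ (by rw [sub_eq_add_neg]
                     exact Set.add_mem_centralizer hT3 (Set.neg_mem_centralizer hstar3)))
  refine ⟨(1 / 2) * (c - Complex.I * d), ?_⟩
  have hT : T = (1 / 2 : ℂ) • ((T + star T) - Complex.I • (Complex.I • (T - star T))) := by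
    rw [smul_smul, Complex.I_mul_I]
    module
  rw [hT, hc, hd]
  module
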